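/- arXiv:1101.4492 — 4 statements merged into one kernel-verified Lean document; each statement's English description precedes it below -/
import Mathlib

section
/- Let G be a finite abelian group, let S be a sequence over G, and let g be an element of Σ•(S), the set of sums of subsequences of S (including 0, the sum of the empty subsequence). If |S| ≥ D(G) − 1, then N_g(S) ≥ 2^{|S|−D(G)+1}. -/
/-- `NSub S g` is the number of subsequences (sub-multisets, counted with the
multiplicity of their appearance in `S`) of the sequence `S` with sum `g`. -/
def NSub {G : Type*} [AddCommGroup G] [DecidableEq G] (S : Multiset G) (g : G) : ℕ :=
  (S.powerset.filter (fun T => T.sum = g)).card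

/-- The Davenport constant of `G`: the smallest positive integer `ℓ` such that every
sequence over `G` of length at least `ℓ` has a nonempty zero-sum subsequence. -/
noncomputable def Davenport (G : Type*) [AddCommGroup G] : ℕ :=
  sInf {ℓ : ℕ | 0 < ℓ ∧ ∀ S : Multiset G, ℓ ≤ Multiset.card S →
    ∃ T : Multiset G, T ≤ S ∧ T ≠ 0 ∧ T.sum = 0}

/-- `ESet S = {g ∈ G : N_g(S) = 2 ^ (|S| - D(G) + 1)}`. -/
def ESet {G : Type*} [AddCommGroup G] [DecidableEq G] (S : Multiset G) : Set G :=
  {g | NSub S g = 2 ^ (Multiset.card S + 1 - Davenport G)}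

/-- A minimal zero-sum sequence: nonempty, zero-sum, and every nonempty proper
subsequence has nonzero sum. -/
def IsMinZeroSum {G : Type*} [AddCommGroup G] (T : Multiset G) : Prop :=
  T ≠ 0 ∧ T.sum = 0 ∧ ∀ U : Multiset G, U ≤ T → U ≠ 0 → U ≠ T → U.sum ≠ 0

theorem NSub_cons {G : Type*} [AddCommGroup G] [DecidableEq G] (a : G) (S : Multiset G) (g : G) :
    NSub (a ::ₘ S) g = NSub S g + NSub S (g - a) := by
  simp only [NSub, Multiset.powerset_cons, Multiset.filter_add, Multiset.card_add,
    Multiset.filter_map, Multiset.card_map, Function.comp_def, Multiset.sum_cons,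
    eq_sub_iff_add_eq']

theorem NSub_pos {G : Type*} [AddCommGroup G] [DecidableEq G] {S : Multiset G} {g : G}
    (hg : ∃ T : Multiset G, T ≤ S ∧ T.sum = g) : 0 < NSub S g := by
  obtain ⟨T, hT, hs⟩ := hg
  exact Multiset.card_pos_iff_exists_mem.2
    ⟨T, Multiset.mem_filter.2 ⟨Multiset.mem_powerset.2 hT, hs⟩⟩

theorem exists_zero_sum_of_card_sq_lt {G : Type*} [AddCommGroup G] [Fintype G] [DecidableEq G]
    (S : Multiset G) (hS : Fintype.card G * Fintype.card G < Multiset.card S) :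
    ∃ T : Multiset G, T ≤ S ∧ T ≠ 0 ∧ T.sum = 0 := by
  obtain ⟨a, ha⟩ : ∃ a, Fintype.card G ≤ S.count a := by
    by_contra! h
    have h1 : ∑ a : G, S.count a = Multiset.card S := Multiset.sum_count_eq_card (by simp)
    have h2 := Finset.sum_le_card_nsmul Finset.univ (fun a => S.count a) _ fun a _ => (h a).le
    rw [h1, Finset.card_univ, smul_eq_mul] at h2
    omega
  refine ⟨Multiset.replicate (Fintype.card G) a, Multiset.le_count_iff_replicate_le.1 ha, ?_, ?_⟩
  · rw [← Multiset.card_pos, Multiset.card_replicate]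
    exact Fintype.card_pos
  · rw [Multiset.sum_replicate, card_nsmul_eq_zero]

theorem Davenport_spec (G : Type*) [AddCommGroup G] [Fintype G] :
    0 < Davenport G ∧ ∀ S : Multiset G, Davenport G ≤ Multiset.card S →
      ∃ T : Multiset G, T ≤ S ∧ T ≠ 0 ∧ T.sum = 0 := by
  classical
  exact Nat.sInf_mem (s := {ℓ : ℕ | 0 < ℓ ∧ ∀ S : Multiset G, ℓ ≤ Multiset.card S →
    ∃ T : Multiset G, T ≤ S ∧ T ≠ 0 ∧ T.sum = 0})
    ⟨Fintype.card G * Fintype.card G + 1, Nat.succ_pos _,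
      fun S hS => exists_zero_sum_of_card_sq_lt S hS⟩

/-- A long sequence `S` representing `g` has a term `a` such that `g` is represented both by a
subsequence containing this term and by one avoiding it. -/
theorem exists_cons_of_Davenport_le {G : Type*} [AddCommGroup G] [Fintype G]
    {S : Multiset G} {g : G} (hg : ∃ T : Multiset G, T ≤ S ∧ T.sum = g)
    (hS : Davenport G ≤ Multiset.card S) :
    ∃ (a : G) (S' : Multiset G), S = a ::ₘ S' ∧ (∃ T : Multiset G, T ≤ S' ∧ T.sum = g) ∧
      ∃ T : Multiset G, T ≤ S' ∧ T.sum = g - a := by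
  classical
  obtain ⟨T, hT, rfl⟩ := hg
  obtain ⟨R, rfl⟩ := Multiset.le_iff_exists_add.1 hT
  obtain ⟨W, hW, hW0, hWs⟩ := (Davenport_spec G).2 (T.map (fun x => -x) + R) (by simpa using hS)
  obtain ⟨A, B, hA, hB, rfl⟩ : ∃ A B : Multiset G, A ≤ T ∧ B ≤ R ∧ W = A.map (fun x => -x) + B := by
    refine ⟨(W ∩ T.map (fun x => -x)).map (fun x => -x), W - T.map (fun x => -x), ?_, ?_, ?_⟩
    · have := Multiset.map_le_map (f := fun x : G => -x)
        (Multiset.inter_le_right (s := W) (t := T.map (fun x => -x)))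
      simpa [Multiset.map_map] using this
    · rw [tsub_le_iff_left]
      exact hW
    · rw [Multiset.map_map]
      simp only [Function.comp_def, neg_neg, Multiset.map_id']
      rw [add_comm, Multiset.sub_add_inter]
  have hAB : A.sum = B.sum := by
    rw [Multiset.sum_add, Multiset.sum_map_neg'] at hWs
    exact neg_add_eq_zero.1 hWs
  obtain ⟨T', rfl⟩ := Multiset.le_iff_exists_add.1 hA
  obtain ⟨R', rfl⟩ := Multiset.le_iff_exists_add.1 hB
  rcases Multiset.empty_or_exists_mem A with rfl | ⟨a, ha⟩
  · rcases Multiset.empty_or_exists_mem B with rfl | ⟨b, hb⟩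
    · simp at hW0
    · obtain ⟨B', rfl⟩ := Multiset.exists_cons_of_mem hb
      refine ⟨b, T' + (B' + R'), by simp, ⟨T', by simp, by simp⟩, T' + B', ?_, ?_⟩
      · rw [← add_assoc]; exact Multiset.le_add_right _ _
      · rw [Multiset.sum_cons, Multiset.sum_zero] at hAB
        rw [zero_add, Multiset.sum_add, eq_sub_iff_add_eq, add_assoc, add_comm B'.sum, ← hAB,
          add_zero]
  · obtain ⟨A', rfl⟩ := Multiset.exists_cons_of_mem ha
    refine ⟨a, A' + T' + (B + R'), by simp, ⟨T' + B, ?_, ?_⟩, A' + T',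
      Multiset.le_add_right _ _, ?_⟩
    · exact add_le_add (Multiset.le_add_left _ _) (Multiset.le_add_right _ _)
    · rw [Multiset.sum_add, Multiset.sum_add, hAB, add_comm]
    · simp

theorem stmt0 {G : Type*} [AddCommGroup G] [Fintype G] [DecidableEq G]
    (S : Multiset G) (g : G)
    (hg : ∃ T : Multiset G, T ≤ S ∧ T.sum = g)
    (hlen : Davenport G - 1 ≤ Multiset.card S) :
    2 ^ (Multiset.card S + 1 - Davenport G) ≤ NSub S g := by
  have hD := (Davenport_spec G).1
  induction h : Multiset.card S + 1 - Davenport G generalizing S g with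
  | zero => exact NSub_pos hg
  | succ k ih =>
    obtain ⟨a, S', rfl, h1, h2⟩ := exists_cons_of_Davenport_le hg (by omega)
    rw [Multiset.card_cons] at h
    rw [NSub_cons, pow_succ, mul_two]
    exact add_le_add (ih S' g h1 (by omega) (by omega)) (ih S' (g - a) h2 (by omega) (by omega))
end

section
/- Let G be a finite abelian group, let S be a sequence over G, and let T be a subsequence of S with σ(T) = g. Then N_g(S) = N_0(T·(−(S·T^{-1}))), where T·(−(S·T^{-1})) is the concatenation of T with the sequence of negatives of the terms of the multiset difference S·T^{-1}. -/
theorem NSub_map_neg {G : Type*} [AddCommGroup G] [DecidableEq G] (S : Multiset G) (g : G) :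
    NSub (S.map (fun x => -x)) (-g) = NSub S g := by
  induction S using Multiset.induction_on generalizing g with
  | empty =>
    by_cases h : g = 0
    · simp [h]
    · simp [NSub, Multiset.filter_singleton, eq_comm (a := (0 : G)), h]
  | cons a S ih =>
    rw [Multiset.map_cons, NSub_cons, NSub_cons, ih, ← ih (g - a), neg_sub_neg, neg_sub]

/-- Negating the terms of a part `T` of a sequence shifts the target sum by `T.sum`. -/
theorem NSub_add_eq_map_neg {G : Type*} [AddCommGroup G] [DecidableEq G] (S T : Multiset G)
    (g : G) : NSub (S + T) g = NSub (S + T.map (fun x => -x)) (g - T.sum) := by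
  induction T using Multiset.induction_on generalizing g with
  | empty => simp
  | cons a T ih =>
    have h : g - (a ::ₘ T).sum - -a = g - T.sum := by rw [Multiset.sum_cons]; abel
    rw [Multiset.map_cons, Multiset.add_cons, Multiset.add_cons, NSub_cons, NSub_cons, h,
      ih, ih, Multiset.sum_cons, sub_sub, add_comm]

theorem stmt1 {G : Type*} [AddCommGroup G] [Fintype G] [DecidableEq G]
    (S T : Multiset G) (g : G) (hT : T ≤ S) (hsum : T.sum = g) :
    NSub S g = NSub (T + (S - T).map (fun x => -x)) 0 := by
  have h := NSub_add_eq_map_neg (S - T) T g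
  rw [tsub_add_cancel_of_le hT, hsum, sub_self] at h
  rw [h, ← NSub_map_neg, neg_zero, Multiset.map_add, Multiset.map_map, add_comm]
  simp
end

section
/- Let G be a finite abelian group and let S be a sequence over G with |S| ≥ D(G) − 1 such that E(S) contains a non-trivial subgroup H of G. Then H is an elementary abelian 2-group, say H ≅ C_2^r, and D(G) = D(G/H) + r. -/
namespace Davenport

/-- A sequence without nonempty zero-sum subsequences. -/
def IsZeroSumFree {G : Type*} [AddCommGroup G] (S : Multiset G) : Prop :=
  ∀ T ≤ S, T.sum = 0 → T = 0

section Constant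

variable {G : Type*} [AddCommGroup G]

theorem exists_sum_eq_zero_of_card_le [Finite G] (S : Multiset G)
    (hS : Nat.card G ≤ Multiset.card S) : ∃ T ≤ S, T ≠ 0 ∧ T.sum = 0 := by
  induction S using Quotient.inductionOn with | h l => ?_
  have := Fintype.ofFinite G
  simp only [Multiset.quot_mk_to_coe, Multiset.coe_card, Nat.card_eq_fintype_card] at hS
  obtain ⟨i, hi, j, hj, hij, h⟩ := Finset.exists_ne_map_eq_of_card_lt_of_maps_to
    (s := Finset.range (l.length + 1)) (t := (Finset.univ : Finset G))
    (f := fun i => (l.take i).sum) (by simp; omega) (by simp)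
  wlog hlt : i < j generalizing i j
  · exact this j hj i hi hij.symm h.symm (by omega)
  simp only [Finset.mem_range] at hi hj
  refine ⟨((l.take j).drop i : List G), ?_, ?_, ?_⟩
  · exact ((List.drop_sublist _ _).trans (List.take_sublist _ _)).subperm
  · rw [Ne, Multiset.coe_eq_zero, ← List.length_eq_zero_iff]
    simp
    omega
  · have h1 := List.sum_take_add_sum_drop (l.take j) i
    rw [List.take_take, min_eq_left hlt.le] at h1
    rw [show (l.take i).sum = (l.take j).sum from h] at h1
    simpa using h1

theorem davenport_spec [Finite G] : 0 < Davenport G ∧ ∀ S : Multiset G,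
    Davenport G ≤ Multiset.card S → ∃ T : Multiset G, T ≤ S ∧ T ≠ 0 ∧ T.sum = 0 :=
  Nat.sInf_mem (s := {ℓ : ℕ | 0 < ℓ ∧ ∀ S : Multiset G, ℓ ≤ Multiset.card S →
    ∃ T : Multiset G, T ≤ S ∧ T ≠ 0 ∧ T.sum = 0})
    ⟨Nat.card G, Nat.card_pos, exists_sum_eq_zero_of_card_le⟩

theorem IsZeroSumFree.card_lt [Finite G] {S : Multiset G} (hS : IsZeroSumFree S) :
    Multiset.card S < Davenport G := by
  by_contra! h
  obtain ⟨T, hT, h0, hs⟩ := davenport_spec.2 S h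
  exact h0 (hS T hT hs)

theorem exists_isZeroSumFree [Finite G] :
    ∃ S : Multiset G, IsZeroSumFree S ∧ Multiset.card S + 1 = Davenport G := by
  have hpos := (davenport_spec (G := G)).1
  obtain h1 | h1 := Nat.eq_or_lt_of_le hpos
  · exact ⟨0, fun T hT _ => Multiset.le_zero.1 hT, by simpa using h1⟩
  · have h2 := Nat.notMem_of_lt_sInf (show Davenport G - 1 < Davenport G by omega)
    simp only [Set.mem_ofPred_eq, not_and, not_forall, not_exists] at h2
    obtain ⟨S, hS, hT⟩ := h2 (by omega)
    have hfree : IsZeroSumFree S := fun T hle hs => by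
      by_contra h0
      exact hT T hle h0 hs
    have := hfree.card_lt
    exact ⟨S, hfree, by omega⟩

theorem addOrderOf_le_davenport [Finite G] (g : G) : addOrderOf g ≤ Davenport G := by
  have hpos := addOrderOf_pos g
  have hfree : IsZeroSumFree (Multiset.replicate (addOrderOf g - 1) g) := by
    intro T hT hs
    obtain ⟨k, hk, rfl⟩ := Multiset.le_replicate_iff.1 hT
    rw [Multiset.sum_replicate] at hs
    have := Nat.eq_zero_of_dvd_of_lt (addOrderOf_dvd_of_nsmul_eq_zero hs) (by omega)
    simp [this]
  have := hfree.card_lt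
  rw [Multiset.card_replicate] at this
  omega

theorem exists_add_of_le_add {α : Type*} {W A B : Multiset α} (h : W ≤ A + B) :
    ∃ W₁ ≤ A, ∃ W₂ ≤ B, W = W₁ + W₂ := by
  classical
  refine ⟨W ∩ A, Multiset.inter_le_right, W - A, ?_, ?_⟩
  · rw [tsub_le_iff_left]
    exact h
  · rw [add_comm, Multiset.sub_add_inter]

theorem davenport_quotient_add_le [Finite G] (H : AddSubgroup G) :
    Davenport (G ⧸ H) + Davenport H ≤ Davenport G + 1 := by
  obtain ⟨A, hA, hAc⟩ := exists_isZeroSumFree (G := H)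
  obtain ⟨B, hB, hBc⟩ := exists_isZeroSumFree (G := G ⧸ H)
  have hfree : IsZeroSumFree (A.map H.subtype + B.map Quotient.out) := by
    intro W hW hs
    obtain ⟨W₁, h₁, W₂, h₂, rfl⟩ := exists_add_of_le_add hW
    have hmem : ∀ x ∈ W₁, x ∈ H := fun x hx => by
      obtain ⟨y, -, rfl⟩ := Multiset.mem_map.1 (Multiset.mem_of_le h₁ hx)
      exact y.2
    lift W₁ to Multiset H using hmem
    have h₁' : W₁ ≤ A := (Multiset.map_le_map_iff Subtype.val_injective).1 h₁
    have hsum : (W₁.map Subtype.val).sum = (W₁.sum : G) := (map_multiset_sum H.subtype W₁).symm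
    rw [Multiset.sum_add, hsum] at hs
    have h₂' : W₂.map (QuotientAddGroup.mk' H) ≤ B := by
      have := Multiset.map_le_map (f := QuotientAddGroup.mk' H) h₂
      simpa [Multiset.map_map, Function.comp_def] using this
    have hz : W₂.map (QuotientAddGroup.mk' H) = 0 := by
      refine hB _ h₂' ?_
      rw [← map_multiset_sum, QuotientAddGroup.mk'_apply, QuotientAddGroup.eq_zero_iff]
      rw [add_comm] at hs
      rw [eq_neg_of_add_eq_zero_left hs]
      exact H.neg_mem W₁.sum.2
    rw [Multiset.map_eq_zero] at hz
    subst hz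
    rw [Multiset.sum_zero, add_zero] at hs
    have : W₁ = 0 := hA _ h₁' (Subtype.ext hs)
    simp [this]
  have := hfree.card_lt
  simp only [Multiset.card_add, Multiset.card_map] at this
  omega

theorem lt_two_pow_pred {n : ℕ} (hn : 3 ≤ n) : n < 2 ^ (n - 1) := by
  induction n, hn using Nat.le_induction with
  | base => norm_num
  | succ n hn ih =>
    obtain ⟨k, rfl⟩ : ∃ k, n = k + 1 := ⟨n - 1, by omega⟩
    simp only [Nat.add_sub_cancel, pow_succ] at ih ⊢
    omega

theorem card_eq_card_quotient_mul_addOrderOf (g : G) :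
    Nat.card G = Nat.card (G ⧸ AddSubgroup.zmultiples g) * addOrderOf g := by
  rw [← Nat.card_zmultiples, ← AddSubgroup.card_eq_card_quotient_mul_card_addSubgroup]

theorem davenport_quotient_zmultiples_add_le [Finite G] (g : G) :
    Davenport (G ⧸ AddSubgroup.zmultiples g) + addOrderOf g ≤ Davenport G + 1 := by
  have h1 := davenport_quotient_add_le (AddSubgroup.zmultiples g)
  have h2 := addOrderOf_le_davenport
    (⟨g, AddSubgroup.mem_zmultiples g⟩ : AddSubgroup.zmultiples g)
  rw [AddSubgroup.addOrderOf_mk] at h2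
  omega

theorem card_le_two_pow [Finite G] : Nat.card G ≤ 2 ^ (Davenport G - 1) := by
  induction hn : Nat.card G using Nat.strong_induction_on generalizing G with | _ n ih => ?_
  subst hn
  rcases subsingleton_or_nontrivial G with hG | hG
  · rw [Nat.card_of_subsingleton (0 : G)]
    exact Nat.one_le_two_pow
  · obtain ⟨g, hg⟩ := exists_ne (0 : G)
    have hord : 2 ≤ addOrderOf g := by
      have := addOrderOf_pos g
      have := mt AddMonoid.addOrderOf_eq_one_iff.1 hg
      omega
    have hcard := card_eq_card_quotient_mul_addOrderOf g
    have hpos : 0 < Nat.card (G ⧸ AddSubgroup.zmultiples g) := Nat.card_pos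
    have hQ := ih _ (by rw [hcard]; nlinarith) (G := G ⧸ AddSubgroup.zmultiples g) rfl
    have hD := davenport_quotient_zmultiples_add_le g
    have hDpos := (davenport_spec (G := G ⧸ AddSubgroup.zmultiples g)).1
    have hlt : addOrderOf g ≤ 2 ^ (addOrderOf g - 1) := by
      have := Nat.lt_two_pow_self (n := addOrderOf g - 1)
      omega
    calc Nat.card G = _ := hcard
      _ ≤ _ := Nat.mul_le_mul hQ hlt
      _ = _ := (pow_add _ _ _).symm
      _ ≤ _ := Nat.pow_le_pow_right two_pos (by omega)

theorem two_nsmul_eq_zero_of_card_eq [Finite G] (h : Nat.card G = 2 ^ (Davenport G - 1)) (g : G) :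
    2 • g = 0 := by
  by_contra hg
  have hord : 3 ≤ addOrderOf g := by
    have h0 := addOrderOf_pos g
    have h1 : addOrderOf g ≠ 1 := fun h1 => hg (by simp [AddMonoid.addOrderOf_eq_one_iff.1 h1])
    have h2 : addOrderOf g ≠ 2 := fun h2 => hg (h2 ▸ addOrderOf_nsmul_eq_zero g)
    omega
  have hD := davenport_quotient_zmultiples_add_le g
  have hDpos := (davenport_spec (G := G ⧸ AddSubgroup.zmultiples g)).1
  refine h.not_lt ?_
  calc Nat.card G = _ := card_eq_card_quotient_mul_addOrderOf g
    _ ≤ _ := Nat.mul_le_mul_right _ card_le_two_pow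
    _ < _ := Nat.mul_lt_mul_of_pos_left (lt_two_pow_pred hord) (by positivity)
    _ = _ := (pow_add _ _ _).symm
    _ ≤ _ := Nat.pow_le_pow_right two_pos (by omega)

end Constant

section Count

variable {G : Type*} [AddCommGroup G] [DecidableEq G]

theorem nSub_zero (g : G) : NSub (0 : Multiset G) g = if g = 0 then 1 else 0 := by
  rw [NSub, Multiset.powerset_zero, Multiset.filter_singleton, Multiset.sum_zero, apply_ite
    Multiset.card]
  simp [eq_comm]

theorem nSub_cons (a : G) (S : Multiset G) (g : G) :
    NSub (a ::ₘ S) g = NSub S g + NSub S (g - a) := by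
  simp only [NSub, Multiset.powerset_cons, Multiset.filter_add, Multiset.card_add,
    Multiset.filter_map, Multiset.card_map, Function.comp_def, Multiset.sum_cons,
    eq_sub_iff_add_eq']

theorem exists_cons_of_davenport_le [Finite G] {S : Multiset G} {g : G}
    (hS : Davenport G ≤ Multiset.card S) (hg : ∃ T ≤ S, T.sum = g) :
    ∃ a S', S = a ::ₘ S' ∧ (∃ T ≤ S', T.sum = g) ∧ ∃ T ≤ S', T.sum = g - a := by
  obtain ⟨R, hR, rfl⟩ := hg
  obtain ⟨V, rfl⟩ := Multiset.le_iff_exists_add.1 hR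
  obtain ⟨A, hA, hA0, hAs⟩ := davenport_spec.2 (R.map Neg.neg + V) (by simpa using hS)
  obtain ⟨A₁, hA₁, U, hU, rfl⟩ := exists_add_of_le_add hA
  obtain ⟨R₂, hR₂⟩ := Multiset.le_iff_exists_add.1 (Multiset.map_le_map (f := Neg.neg) hA₁)
  obtain ⟨V₂, rfl⟩ := Multiset.le_iff_exists_add.1 hU
  simp only [Multiset.map_map, Function.comp_def, neg_neg, Multiset.map_id'] at hR₂
  have hsum : (A₁.map Neg.neg).sum = U.sum := by
    rw [Multiset.sum_add] at hAs
    rw [Multiset.sum_map_neg', eq_neg_of_add_eq_zero_left hAs, neg_neg]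
  have hne : A₁.map Neg.neg ≠ 0 ∨ U ≠ 0 := by
    by_contra! h
    rw [Multiset.map_eq_zero] at h
    exact hA0 (by simp [h])
  generalize A₁.map Neg.neg = R₁ at *
  subst hR₂
  rcases hne with hne | hne
  · obtain ⟨a, ha⟩ := Multiset.exists_mem_of_ne_zero hne
    obtain ⟨R', rfl⟩ := Multiset.exists_cons_of_mem ha
    refine ⟨a, R' + R₂ + (U + V₂), by simp, ⟨R₂ + U, ?_, ?_⟩, R' + R₂, ?_, ?_⟩
    · exact Multiset.le_iff_exists_add.2 ⟨R' + V₂, by abel⟩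
    · simp only [Multiset.sum_add, ← hsum]
      abel
    · exact Multiset.le_add_right _ _
    · simp only [Multiset.sum_add, Multiset.sum_cons]
      abel
  · obtain ⟨a, ha⟩ := Multiset.exists_mem_of_ne_zero hne
    obtain ⟨U', rfl⟩ := Multiset.exists_cons_of_mem ha
    refine ⟨a, R₁ + R₂ + (U' + V₂), by simp, ⟨R₁ + R₂, ?_, rfl⟩, R₂ + U', ?_, ?_⟩
    · exact Multiset.le_add_right _ _
    · exact Multiset.le_iff_exists_add.2 ⟨R₁ + V₂, by abel⟩
    · simp only [Multiset.sum_add, hsum, Multiset.sum_cons]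
      abel

/-- Olson's lower bound for the number of subsequences with a prescribed attained sum. -/
theorem two_pow_le_nSub [Finite G] (S : Multiset G) (g : G) (hg : ∃ T ≤ S, T.sum = g) :
    2 ^ (Multiset.card S + 1 - Davenport G) ≤ NSub S g := by
  induction hn : Multiset.card S generalizing S g with
  | zero =>
    have hpos := (davenport_spec (G := G)).1
    obtain rfl := Multiset.card_eq_zero.1 hn
    obtain ⟨T, hT, rfl⟩ := hg
    obtain rfl := Multiset.le_zero.1 hT
    rw [show 0 + 1 - Davenport G = 0 by omega]
    simp [nSub_zero]
  | succ n ih =>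
    rcases lt_or_ge (n + 1) (Davenport G) with hlt | hge
    · rw [show n + 1 + 1 - Davenport G = 0 by omega]
      obtain ⟨T, hT, hs⟩ := hg
      exact Multiset.card_pos_iff_exists_mem.2
        ⟨T, Multiset.mem_filter.2 ⟨Multiset.mem_powerset.2 hT, hs⟩⟩
    · obtain ⟨a, S', rfl, h1, h2⟩ := exists_cons_of_davenport_le (hn ▸ hge) hg
      rw [Multiset.card_cons, Nat.succ_inj] at hn
      have i1 := ih S' g h1 hn
      have i2 := ih S' (g - a) h2 hn
      rw [nSub_cons, show n + 1 + 1 - Davenport G = n + 1 - Davenport G + 1 by omega, pow_succ]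
      omega

theorem nSub_map_mk [Finite G] (H : AddSubgroup G) [Fintype H] [DecidableEq (G ⧸ H)]
    (S : Multiset G) (g : G) :
    NSub (S.map (QuotientAddGroup.mk' H)) (QuotientAddGroup.mk' H g) =
      ∑ h : H, NSub S (g + h) := by
  induction S using Multiset.induction_on generalizing g with
  | empty =>
    simp only [nSub_zero, Multiset.map_zero, add_eq_zero_iff_neg_eq, QuotientAddGroup.mk'_apply]
    by_cases hg : g ∈ H
    · rw [if_pos ((QuotientAddGroup.eq_zero_iff g).2 hg), Finset.sum_eq_single ⟨-g, H.neg_mem hg⟩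
        (fun b _ hb => if_neg fun h => hb (Subtype.ext h.symm)) (by simp)]
      simp
    · rw [if_neg (mt (QuotientAddGroup.eq_zero_iff g).1 hg), Finset.sum_eq_zero]
      intro h _
      exact if_neg fun hh : -g = (h : G) => hg (H.neg_mem_iff.1 (hh ▸ h.2))
  | cons a S ih =>
    rw [Multiset.map_cons, nSub_cons, ← map_sub, ih, ih, ← Finset.sum_add_distrib]
    refine Finset.sum_congr rfl fun h _ => ?_
    rw [nSub_cons, add_sub_right_comm]

end Count

theorem exists_equiv_zmod_two_of_two_nsmul {G : Type*} [AddCommGroup G] [Finite G]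
    (h : ∀ g : G, 2 • g = 0) :
    ∃ r : ℕ, Nonempty (G ≃+ (Fin r → ZMod 2)) ∧ Nat.card G = 2 ^ r := by
  let _ : Module (ZMod 2) G := AddCommGroup.zmodModule h
  have e := (Module.finBasis (ZMod 2) G).equivFun.toAddEquiv
  exact ⟨_, ⟨e⟩, by rw [Nat.card_congr e.toEquiv]; simp⟩

end Davenport

theorem stmt6 {G : Type*} [AddCommGroup G] [Fintype G] [DecidableEq G]
    (S : Multiset G) (hlen : Davenport G - 1 ≤ Multiset.card S)
    (H : AddSubgroup G) (hne : H ≠ ⊥) (hsub : (H : Set G) ⊆ ESet S) :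
    ∃ r : ℕ, Nonempty (H ≃+ (Fin r → ZMod 2)) ∧
      Davenport G = Davenport (G ⧸ H) + r := by
  classical
  have hpos := (Davenport.davenport_spec (G := G)).1
  have hQpos := (Davenport.davenport_spec (G := G ⧸ H)).1
  have hHpos := (Davenport.davenport_spec (G := H)).1
  have hadd := Davenport.davenport_quotient_add_le H
  have hcount : NSub (S.map (QuotientAddGroup.mk' H)) 0 =
      Nat.card H * 2 ^ (Multiset.card S + 1 - Davenport G) := by
    rw [← map_zero (QuotientAddGroup.mk' H), Davenport.nSub_map_mk,
      Finset.sum_congr rfl fun h _ => (zero_add (h : G)).symm ▸ hsub h.2]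
    simp
  have holson := Davenport.two_pow_le_nSub (S.map (QuotientAddGroup.mk' H)) 0
    ⟨0, Multiset.zero_le _, Multiset.sum_zero⟩
  rw [hcount, Multiset.card_map, show Multiset.card S + 1 - Davenport (G ⧸ H) =
    Davenport G - Davenport (G ⧸ H) + (Multiset.card S + 1 - Davenport G) by omega,
    pow_add] at holson
  have hlower := Nat.le_of_mul_le_mul_right holson (by positivity)
  have hupper := Davenport.card_le_two_pow (G := H)
  have hexp := (Nat.pow_le_pow_iff_right one_lt_two).1 (hlower.trans hupper)
  have hcard : Nat.card H = 2 ^ (Davenport H - 1) :=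
    hupper.antisymm (by rwa [show Davenport H - 1 = Davenport G - Davenport (G ⧸ H) by omega])
  obtain ⟨r, he, hr⟩ := Davenport.exists_equiv_zmod_two_of_two_nsmul
    (Davenport.two_nsmul_eq_zero_of_card_eq hcard)
  have := Nat.pow_right_injective le_rfl (hcard.symm.trans hr)
  exact ⟨r, he, by omega⟩
end

section
/- Let G be a finite abelian group of odd order and let S be a sequence over G with 0 not a term of S, |S| ≥ D(G) − 1, and E(S) = {0}. Then S contains exactly r = |S| − D(G) + 1 minimal zero-sum subsequences T_1, …, T_r, these are pairwise disjoint, and S = T_1 T_2 ⋯ T_r (S is the multiset union of them, with nothing else). -/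
section ZeroSumFinsets

variable {G : Type*} [AddCommGroup G] {ι : Type*}

theorem exists_davenport_bound [Fintype G] :
    ∃ ℓ : ℕ, 0 < ℓ ∧ ∀ S : Multiset G, ℓ ≤ Multiset.card S →
      ∃ T : Multiset G, T ≤ S ∧ T ≠ 0 ∧ T.sum = 0 := by
  classical
  refine ⟨Fintype.card G * Fintype.card G, Nat.mul_pos Fintype.card_pos Fintype.card_pos, ?_⟩
  intro S hS
  obtain ⟨g, hg⟩ : ∃ g : G, Fintype.card G ≤ S.count g := by
    by_contra! h
    have h1 : ∑ g : G, S.count g < ∑ _g : G, Fintype.card G :=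
      Finset.sum_lt_sum_of_nonempty Finset.univ_nonempty fun g _ => h g
    rw [Multiset.sum_count_eq_card fun a _ => Finset.mem_univ a] at h1
    simp at h1
    omega
  refine ⟨Multiset.replicate (Fintype.card G) g, Multiset.le_count_iff_replicate_le.1 hg, ?_, ?_⟩
  · intro h
    have := congrArg Multiset.card h
    simp at this
  · rw [Multiset.sum_replicate, card_nsmul_eq_zero]

theorem davenport_spec [Fintype G] (S : Multiset G) (hS : Davenport G ≤ Multiset.card S) :
    ∃ T : Multiset G, T ≤ S ∧ T ≠ 0 ∧ T.sum = 0 :=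
  (Nat.sInf_mem (exists_davenport_bound (G := G))).2 S hS

theorem eq_zero_of_add_self [Fintype G] (hodd : Odd (Fintype.card G)) {a : G} (ha : a + a = 0) :
    a = 0 := by
  have h1 : addOrderOf a ∣ 2 := addOrderOf_dvd_of_nsmul_eq_zero (by rw [two_nsmul, ha])
  have h2 : addOrderOf a ∣ Fintype.card G := addOrderOf_dvd_card
  have h3 : addOrderOf a = 1 :=
    Nat.eq_one_of_dvd_coprimes (Nat.coprime_two_left.2 hodd) h1 h2
  exact AddMonoid.addOrderOf_eq_one_iff.1 h3

/-- The subsets of `I` over which `s` sums to zero. -/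
def zeroSums [DecidableEq G] (s : ι → G) (I : Finset ι) : Finset (Finset ι) :=
  I.powerset.filter fun J => ∑ i ∈ J, s i = 0

theorem mem_zeroSums [DecidableEq G] {s : ι → G} {I J : Finset ι} :
    J ∈ zeroSums s I ↔ J ⊆ I ∧ ∑ i ∈ J, s i = 0 := by
  simp [zeroSums]

/-- Nonempty index sets minimal among those over which `s` sums to zero. -/
def IsMinZero (s : ι → G) (A : Finset ι) : Prop :=
  A.Nonempty ∧ ∑ i ∈ A, s i = 0 ∧ ∀ B ⊆ A, B.Nonempty → ∑ i ∈ B, s i = 0 → B = A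

variable [DecidableEq ι]

theorem powerset_map_val {α : Type*} (s : ι → α) (I : Finset ι) :
    (I.val.map s).powerset = I.powerset.val.map fun J => J.val.map s := by
  induction I using Finset.induction_on with
  | empty => rfl
  | insert a I ha ih =>
    have hinj : Set.InjOn (insert a) (I.powerset : Set (Finset ι)) := by
      intro J hJ K hK h
      have hJ' : a ∉ J := fun h => ha (Finset.mem_powerset.1 hJ h)
      have hK' : a ∉ K := fun h => ha (Finset.mem_powerset.1 hK h)
      rw [← Finset.erase_insert hJ', ← Finset.erase_insert hK', h]
    have hdis : Disjoint I.powerset (I.powerset.image (insert a)) := by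
      rw [Finset.disjoint_left]
      intro J hJ hJ'
      obtain ⟨K, -, rfl⟩ := Finset.mem_image.1 hJ'
      exact ha (Finset.mem_powerset.1 hJ (Finset.mem_insert_self a K))
    rw [Finset.insert_val_of_notMem ha, Multiset.map_cons, Multiset.powerset_cons, ih,
      Finset.powerset_insert, ← Finset.disjUnion_eq_union _ _ hdis, Finset.disjUnion_val,
      Multiset.map_add, Finset.image_val_of_injOn hinj, Multiset.map_map, Multiset.map_map]
    congr 1
    refine Multiset.map_congr rfl fun J hJ => ?_
    have hJ' : a ∉ J := fun h => ha (Finset.mem_powerset.1 hJ h)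
    simp [Finset.insert_val_of_notMem hJ']

theorem exists_finset_of_le_map {α : Type*} (s : ι → α) (I : Finset ι) {T : Multiset α}
    (hT : T ≤ I.val.map s) : ∃ J ⊆ I, J.val.map s = T := by
  rw [← Multiset.mem_powerset, powerset_map_val, Multiset.mem_map] at hT
  obtain ⟨J, hJ, rfl⟩ := hT
  exact ⟨J, Finset.mem_powerset.1 hJ, rfl⟩

theorem exists_zeroSum_finset [Fintype G] (s : ι → G) (I : Finset ι) (hI : Davenport G ≤ I.card) :
    ∃ J ⊆ I, J.Nonempty ∧ ∑ i ∈ J, s i = 0 := by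
  obtain ⟨T, hT, hne, hsum⟩ := davenport_spec (I.val.map s) (by simpa using hI)
  obtain ⟨J, hJ, rfl⟩ := exists_finset_of_le_map s I hT
  refine ⟨J, hJ, ?_, hsum⟩
  rw [Finset.nonempty_iff_ne_empty]
  rintro rfl
  exact hne rfl

theorem sum_sdiff_eq_zero {s : ι → G} {J B : Finset ι} (hB : B ⊆ J)
    (hJ0 : ∑ i ∈ J, s i = 0) (hB0 : ∑ i ∈ B, s i = 0) : ∑ i ∈ J \ B, s i = 0 := by
  have := Finset.sum_sdiff (f := s) hB
  rwa [hB0, hJ0, add_zero] at this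

theorem exists_isMinZero_mem {s : ι → G} {J : Finset ι} (hJ : ∑ i ∈ J, s i = 0) {k : ι}
    (hk : k ∈ J) : ∃ P ⊆ J, IsMinZero s P ∧ k ∈ P := by
  induction J using Finset.strongInduction with
  | H J ih =>
    by_cases hmin : IsMinZero s J
    · exact ⟨J, subset_rfl, hmin, hk⟩
    obtain ⟨B, hB, hBne, hB0, hBJ⟩ :
        ∃ B ⊆ J, B.Nonempty ∧ ∑ i ∈ B, s i = 0 ∧ B ≠ J := by
      by_contra! h
      exact hmin ⟨⟨k, hk⟩, hJ, h⟩
    by_cases hkB : k ∈ B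
    · obtain ⟨P, hP, h⟩ := ih B (hB.ssubset_of_ne hBJ) hB0 hkB
      exact ⟨P, hP.trans hB, h⟩
    · obtain ⟨P, hP, h⟩ := ih (J \ B) (Finset.sdiff_ssubset hB hBne)
        (sum_sdiff_eq_zero hB hJ hB0) (Finset.mem_sdiff.2 ⟨hk, hkB⟩)
      exact ⟨P, hP.trans Finset.sdiff_subset, h⟩

theorem value_ne_of_disjoint {s : ι → G} {I : Finset ι} (h0 : ∀ i ∈ I, s i ≠ 0)
    (hd : ∀ A ⊆ I, ∀ B ⊆ I, IsMinZero s A → IsMinZero s B → A ≠ B → Disjoint A B)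
    {A B : Finset ι} (hAI : A ⊆ I) (hBI : B ⊆ I) (hA : IsMinZero s A) (hB : IsMinZero s B)
    (hAB : A ≠ B) {i j : ι} (hi : i ∈ A) (hj : j ∈ B) : s i ≠ s j := by
  intro hij
  have hdis := hd A hAI B hBI hA hB hAB
  have hjA : j ∉ A := fun h => Finset.disjoint_left.1 hdis h hj
  have hsum : ∑ k ∈ insert j (A.erase i), s k = 0 := by
    rw [Finset.sum_insert fun h => hjA (Finset.mem_of_mem_erase h), ← hij,
      Finset.add_sum_erase A s hi, hA.2.1]
  obtain ⟨k, hk⟩ : (A.erase i).Nonempty := by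
    rw [Finset.nonempty_iff_ne_empty]
    intro h
    have := Finset.add_sum_erase A s hi
    rw [h, Finset.sum_empty, add_zero, hA.2.1] at this
    exact h0 i (hAI hi) this
  obtain ⟨P, hP, hPmin, hkP⟩ := exists_isMinZero_mem hsum (Finset.mem_insert_of_mem hk)
  have hPI : P ⊆ I := hP.trans (Finset.insert_subset (hBI hj) ((Finset.erase_subset _ _).trans hAI))
  have hPA : P = A := by
    by_contra hne
    exact Finset.disjoint_left.1 (hd P hPI A hAI hPmin hA hne) hkP (Finset.mem_of_mem_erase hk)
  have hiP : i ∈ insert j (A.erase i) := hP (hPA ▸ hi)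
  rcases Finset.mem_insert.1 hiP with rfl | h
  · exact hjA hi
  · exact Finset.notMem_erase i A h

theorem isMinZeroSum_map_iff {s : ι → G} {A : Finset ι} :
    IsMinZeroSum (A.val.map s) ↔ IsMinZero s A := by
  have hne : ∀ B : Finset ι, B.val.map s ≠ 0 ↔ B.Nonempty := by
    intro B
    rw [Finset.nonempty_iff_ne_empty, Ne, Multiset.map_eq_zero, Finset.val_eq_zero]
  refine and_congr (hne A) (and_congr Iff.rfl ⟨fun h B hB hBne hB0 => ?_, fun h U hU hUne hUA => ?_⟩)
  · by_contra hBA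
    refine h (B.val.map s) (Multiset.map_le_map (Finset.val_le_iff.2 hB)) ((hne B).2 hBne) ?_ hB0
    intro heq
    have := congrArg Multiset.card heq
    simp only [Multiset.card_map, Finset.card_val] at this
    exact hBA (Finset.eq_of_subset_of_card_le hB this.ge)
  · obtain ⟨B, hB, rfl⟩ := exists_finset_of_le_map s A hU
    intro h0
    exact hUA (by rw [h B hB ((hne B).1 hUne) h0])

variable [DecidableEq G]

theorem card_zeroSums_eq_add (s : ι → G) (I : Finset ι) (g : ι) :
    (zeroSums s I).card =
      (zeroSums s (I.erase g)).card + ((zeroSums s I).filter fun J => g ∈ J).card := by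
  rw [← Finset.card_filter_add_card_filter_not (s := zeroSums s I) (fun J => g ∈ J), add_comm]
  congr 2
  ext J
  simp only [Finset.mem_filter, mem_zeroSums, Finset.subset_erase]
  tauto

theorem card_zeroSums_neg_le (s : ι → G) {I T : Finset ι} (hTI : T ⊆ I)
    (hT : ∑ i ∈ T, s i = 0) {g : ι} (hg : g ∈ T) :
    (zeroSums (fun i => if i ∈ T then -s i else s i) (I.erase g)).card ≤
      ((zeroSums s I).filter fun J => g ∈ J).card := by
  refine Finset.card_le_card_of_injOn (fun J => symmDiff J T) ?_
    fun J _ K _ h => symmDiff_left_injective T h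
  intro J hJ
  obtain ⟨hJI, hJ0⟩ := mem_zeroSums.1 hJ
  obtain ⟨hJI, hgJ⟩ := Finset.subset_erase.1 hJI
  simp only [Finset.coe_filter, Set.mem_ofPred_eq, mem_zeroSums]
  refine ⟨⟨?_, ?_⟩, Finset.mem_symmDiff.2 (Or.inr ⟨hg, hgJ⟩)⟩
  · intro x hx
    rcases Finset.mem_symmDiff.1 hx with h | h
    · exact hJI h.1
    · exact hTI h.1
  · have hunion : symmDiff J T = (J \ T) ∪ (T \ J) := rfl
    rw [hunion, Finset.sum_union (Finset.disjoint_left.2 fun x hx hx' => by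
      simp only [Finset.mem_sdiff] at hx hx'; exact hx.2 hx'.1)]
    have h1 := Finset.sum_inter_add_sum_sdiff J T (fun i => if i ∈ T then -s i else s i)
    have h2 := Finset.sum_inter_add_sum_sdiff T J s
    rw [hJ0, Finset.sum_congr rfl (g := fun i => -s i) fun i hi =>
        if_pos (Finset.mem_inter.1 hi).2,
      Finset.sum_congr (s₁ := J \ T) rfl (g := s) fun i hi => if_neg (Finset.mem_sdiff.1 hi).2,
      Finset.sum_neg_distrib] at h1
    rw [hT, Finset.inter_comm] at h2
    rw [← add_zero 0]
    nth_rewrite 1 [← h1]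
    rw [← h2]
    abel

/-- Olson's lower bound for the number of zero-sum subsequences. -/
theorem two_pow_le_card_zeroSums [Fintype G] (s : ι → G) (I : Finset ι) :
    2 ^ (I.card + 1) ≤ (zeroSums s I).card * 2 ^ Davenport G := by
  induction hn : I.card generalizing s I with
  | zero =>
    obtain rfl := Finset.card_eq_zero.1 hn
    have hD : 0 < Davenport G := (Nat.sInf_mem (exists_davenport_bound (G := G))).1
    have h1 : 0 < (zeroSums s ∅).card := Finset.card_pos.2 ⟨∅, mem_zeroSums.2 (by simp)⟩
    calc 2 ^ (0 + 1) ≤ 2 ^ Davenport G := Nat.pow_le_pow_right two_pos hD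
      _ ≤ _ := Nat.le_mul_of_pos_left _ h1
  | succ n ih =>
    by_cases hD : Davenport G ≤ I.card
    · obtain ⟨T, hTI, ⟨g, hg⟩, hT⟩ := exists_zeroSum_finset s I hD
      have hcard : (I.erase g).card = n := by rw [Finset.card_erase_of_mem (hTI hg)]; omega
      have h1 := ih s _ hcard
      have h2 := (ih _ _ hcard).trans
        (Nat.mul_le_mul_right _ (card_zeroSums_neg_le s hTI hT hg))
      rw [card_zeroSums_eq_add s I g, add_mul, pow_succ]
      omega
    · have h1 : 0 < (zeroSums s I).card := Finset.card_pos.2 ⟨∅, mem_zeroSums.2 (by simp)⟩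
      calc 2 ^ (n + 1 + 1) ≤ 2 ^ Davenport G := Nat.pow_le_pow_right two_pos (by omega)
        _ ≤ _ := Nat.le_mul_of_pos_left _ h1

/-- Equality in Olson's lower bound. -/
def IsTight (s : ι → G) (I : Finset ι) : Prop :=
  (zeroSums s I).card * 2 ^ Davenport G = 2 ^ (I.card + 1)

theorem IsTight.erase_and_card [Fintype G] {s : ι → G} {I T : Finset ι} (hI : IsTight s I)
    (hTI : T ⊆ I) (hT : ∑ i ∈ T, s i = 0) {g : ι} (hg : g ∈ T) :
    IsTight s (I.erase g) ∧ 2 * (zeroSums s (I.erase g)).card = (zeroSums s I).card ∧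
      2 * ((zeroSums s I).filter fun J => g ∈ J).card = (zeroSums s I).card := by
  have hcard : (I.erase g).card + 1 = I.card := Finset.card_erase_add_one (hTI hg)
  have h1 := two_pow_le_card_zeroSums s (I.erase g)
  have h2 := (two_pow_le_card_zeroSums _ _).trans
    (Nat.mul_le_mul_right _ (card_zeroSums_neg_le s hTI hT hg))
  have h3 := card_zeroSums_eq_add s I g
  have h4 := hI
  unfold IsTight at h4 ⊢
  rw [hcard] at h1 h2 ⊢
  rw [h3, add_mul, pow_succ] at h4
  have h5 : (zeroSums s (I.erase g)).card * 2 ^ Davenport G = 2 ^ I.card := by omega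
  have h6 : ((zeroSums s I).filter fun J => g ∈ J).card * 2 ^ Davenport G = 2 ^ I.card := by omega
  have h7 := Nat.eq_of_mul_eq_mul_right (by positivity) (h5.trans h6.symm)
  exact ⟨h5, by omega, by omega⟩

theorem disjoint_of_card_zeroSums_erase [Fintype G] (hodd : Odd (Fintype.card G)) {s : ι → G}
    {I T₁ T₂ : Finset ι} (hI : IsTight s I) (h₁I : T₁ ⊆ I) (h₂I : T₂ ⊆ I)
    (h₁ : IsMinZero s T₁) (h₂ : IsMinZero s T₂) (hne : T₁ ≠ T₂)
    (hsub : ∀ C ⊆ I, ∑ i ∈ C, s i = 0 → C ⊆ T₁ ∪ T₂) (hcard : (zeroSums s I).card ≤ 4) :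
    Disjoint T₁ T₂ := by
  by_contra hdis
  obtain ⟨y, hy₁, hy₂⟩ := Finset.not_disjoint_iff.1 hdis
  have hmem : ∀ C, C ∈ zeroSums s I → ∀ z ∈ C, (zeroSums s (I.erase z)).card ≤ 2 ∧
      ((zeroSums s I).filter fun J => z ∈ J).card ≤ 2 := by
    intro C hC z hz
    obtain ⟨-, h, h'⟩ := hI.erase_and_card (mem_zeroSums.1 hC).1 (mem_zeroSums.1 hC).2 hz
    omega
  have m₁ : T₁ ∈ zeroSums s I := mem_zeroSums.2 ⟨h₁I, h₁.2.1⟩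
  have m₂ : T₂ ∈ zeroSums s I := mem_zeroSums.2 ⟨h₂I, h₂.2.1⟩
  obtain ⟨C, hC, hCne⟩ : ∃ C ∈ zeroSums s (I.erase y), C ≠ ∅ := by
    by_contra! h
    obtain ⟨-, h5, h6⟩ := hI.erase_and_card h₁I h₁.2.1 hy₁
    have h7 : (zeroSums s (I.erase y)).card ≤ 1 :=
      Finset.card_le_one.2 fun a ha b hb => (h a ha).trans (h b hb).symm
    have h8 : ({T₁, T₂} : Finset (Finset ι)).card ≤
        ((zeroSums s I).filter fun J => y ∈ J).card :=
      Finset.card_le_card (by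
        intro J hJ
        rcases Finset.mem_insert.1 hJ with rfl | hJ
        · exact Finset.mem_filter.2 ⟨m₁, hy₁⟩
        · obtain rfl := Finset.mem_singleton.1 hJ
          exact Finset.mem_filter.2 ⟨m₂, hy₂⟩)
    rw [Finset.card_pair hne] at h8
    omega
  obtain ⟨hCI, hC0⟩ := mem_zeroSums.1 hC
  obtain ⟨hCI, hyC⟩ := Finset.subset_erase.1 hCI
  have mC : C ∈ zeroSums s I := mem_zeroSums.2 ⟨hCI, hC0⟩
  have hC₁ : C ≠ T₁ := fun h => hyC (h ▸ hy₁)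
  have hC₂ : C ≠ T₂ := fun h => hyC (h ▸ hy₂)
  have avoid : ∀ A B, A ∈ zeroSums s I → B ∈ zeroSums s I → B.Nonempty → C ≠ B →
      ∀ z ∈ A, z ∉ B → z ∈ C := by
    intro A B mA mB hB hCB z hzA hzB
    by_contra hzC
    have h := (hmem A mA z hzA).1
    have h8 : ({∅, B, C} : Finset (Finset ι)).card ≤ (zeroSums s (I.erase z)).card :=
      Finset.card_le_card (by
        intro J hJ
        simp only [Finset.mem_insert, Finset.mem_singleton] at hJ
        rw [mem_zeroSums] at mB mC ⊢
        rw [Finset.subset_erase]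
        rcases hJ with rfl | rfl | rfl
        · simp
        · exact ⟨⟨mB.1, hzB⟩, mB.2⟩
        · exact ⟨⟨mC.1, hzC⟩, mC.2⟩)
    rw [Finset.card_eq_three.2 ⟨_, _, _, hB.ne_empty.symm, hCne.symm, hCB.symm, rfl⟩] at h8
    omega
  have hCeq : C = (T₁ \ T₂) ∪ (T₂ \ T₁) := by
    ext z
    simp only [Finset.mem_union, Finset.mem_sdiff]
    constructor
    · intro hz
      have hz' := Finset.mem_union.1 (hsub C hCI hC0 hz)
      by_contra hcon
      have hz₁ : z ∈ T₁ := by tauto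
      have hz₂ : z ∈ T₂ := by tauto
      have h := (hmem T₁ m₁ z hz₁).2
      have h8 : ({T₁, T₂, C} : Finset (Finset ι)).card ≤
          ((zeroSums s I).filter fun J => z ∈ J).card :=
        Finset.card_le_card (by
          intro J hJ
          simp only [Finset.mem_insert, Finset.mem_singleton] at hJ
          rw [Finset.mem_filter]
          rcases hJ with rfl | rfl | rfl
          · exact ⟨m₁, hz₁⟩
          · exact ⟨m₂, hz₂⟩
          · exact ⟨mC, hz⟩)
      rw [Finset.card_eq_three.2 ⟨_, _, _, hne, hC₁.symm, hC₂.symm, rfl⟩] at h8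
      omega
    · rintro (⟨hz, hz'⟩ | ⟨hz, hz'⟩)
      · exact avoid T₁ T₂ m₁ m₂ h₂.1 hC₂ z hz hz'
      · exact avoid T₂ T₁ m₂ m₁ h₁.1 hC₁ z hz hz'
  have e₁ := Finset.sum_inter_add_sum_sdiff T₁ T₂ s
  have e₂ := Finset.sum_inter_add_sum_sdiff T₂ T₁ s
  rw [h₁.2.1] at e₁
  rw [h₂.2.1, Finset.inter_comm] at e₂
  rw [hCeq, Finset.sum_union (Finset.disjoint_left.2 fun x hx hx' => by
      simp only [Finset.mem_sdiff] at hx hx'; exact hx.2 hx'.1)] at hC0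
  have hY : ∑ i ∈ T₁ ∩ T₂, s i = 0 := by
    apply eq_zero_of_add_self hodd
    calc _ = (∑ i ∈ T₁ ∩ T₂, s i + ∑ i ∈ T₁ \ T₂, s i) +
          (∑ i ∈ T₁ ∩ T₂, s i + ∑ i ∈ T₂ \ T₁, s i) -
          (∑ i ∈ T₁ \ T₂, s i + ∑ i ∈ T₂ \ T₁, s i) := by abel
      _ = 0 := by rw [e₁, e₂, hC0]; simp
  have hYne : (T₁ ∩ T₂).Nonempty := ⟨y, Finset.mem_inter.2 ⟨hy₁, hy₂⟩⟩
  exact hne ((h₁.2.2 _ Finset.inter_subset_left hYne hY).symm.trans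
    (h₂.2.2 _ Finset.inter_subset_right hYne hY))

theorem IsTight.disjoint [Fintype G] (hodd : Odd (Fintype.card G)) {s : ι → G} {I : Finset ι}
    (hI : IsTight s I) {T₁ T₂ : Finset ι} (h₁I : T₁ ⊆ I) (h₂I : T₂ ⊆ I)
    (h₁ : IsMinZero s T₁) (h₂ : IsMinZero s T₂) (hne : T₁ ≠ T₂) : Disjoint T₁ T₂ := by
  induction I using Finset.strongInduction generalizing T₁ T₂ with
  | H I ih =>
    by_cases hsub : ∀ C ⊆ I, ∑ i ∈ C, s i = 0 → C ⊆ T₁ ∪ T₂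
    · obtain ⟨x, hx₁, hx₂⟩ := Finset.not_subset.1
        fun h : T₁ ⊆ T₂ => hne (h₂.2.2 T₁ h h₁.1 h₁.2.1)
      obtain ⟨htight, hcard, -⟩ := hI.erase_and_card h₁I h₁.2.1 hx₁
      have hsmall : zeroSums s (I.erase x) ⊆ {∅, T₂} := by
        intro J hJ
        obtain ⟨hJI, hJ0⟩ := mem_zeroSums.1 hJ
        have within : ∀ K ⊆ J, ∑ i ∈ K, s i = 0 → Disjoint K T₂ → K = ∅ := by
          intro K hK hK0 hd
          by_contra hKne
          have hKI := hK.trans hJI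
          have hK₁ : K ⊆ T₁ := fun z hz =>
            (Finset.mem_union.1 (hsub K (hKI.trans (Finset.erase_subset _ _)) hK0 hz)).resolve_right
              (Finset.disjoint_left.1 hd hz)
          have := h₁.2.2 K hK₁ (Finset.nonempty_iff_ne_empty.2 hKne) hK0
          exact (Finset.subset_erase.1 hKI).2 (this ▸ hx₁)
        rcases J.eq_empty_or_nonempty with rfl | ⟨k, hk⟩
        · simp
        obtain ⟨P, hPJ, hP, -⟩ := exists_isMinZero_mem hJ0 hk
        have hPT : P = T₂ := by
          by_contra hPT
          exact hP.1.ne_empty (within P hPJ hP.2.1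
            (ih _ (Finset.erase_ssubset (h₁I hx₁)) htight (hPJ.trans hJI)
              (Finset.subset_erase.2 ⟨h₂I, hx₂⟩) hP h₂ hPT))
        subst hPT
        have := within (J \ P) Finset.sdiff_subset (sum_sdiff_eq_zero hPJ hJ0 hP.2.1)
          Finset.sdiff_disjoint
        rw [Finset.sdiff_eq_empty_iff_subset] at this
        simp [this.antisymm hPJ]
      have := (Finset.card_le_card hsmall).trans Finset.card_le_two
      exact disjoint_of_card_zeroSums_erase hodd hI h₁I h₂I h₁ h₂ hne hsub (by omega)
    · push Not at hsub
      obtain ⟨C, hCI, hC0, hC⟩ := hsub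
      obtain ⟨x, hxC, hx⟩ := Finset.not_subset.1 hC
      rw [Finset.mem_union, not_or] at hx
      exact ih _ (Finset.erase_ssubset (hCI hxC)) (hI.erase_and_card hCI hC0 hxC).1
        (Finset.subset_erase.2 ⟨h₁I, hx.1⟩) (Finset.subset_erase.2 ⟨h₂I, hx.2⟩) h₁ h₂ hne

theorem card_zeroSums_eq_two_pow {s : ι → G} {I : Finset ι} {M : Finset (Finset ι)}
    (hM : ∀ A, A ∈ M ↔ A ⊆ I ∧ IsMinZero s A)
    (hd : ∀ A ∈ M, ∀ B ∈ M, A ≠ B → Disjoint A B) :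
    (zeroSums s I).card = 2 ^ M.card := by
  have key : ∀ F ⊆ M, ∀ A ∈ M, A ⊆ F.biUnion id → A ∈ F := by
    intro F hF A hA hsub
    obtain ⟨a, ha⟩ := ((hM A).1 hA).2.1
    obtain ⟨B, hB, haB⟩ := Finset.mem_biUnion.1 (hsub ha)
    by_contra hAF
    exact Finset.disjoint_left.1 (hd A hA B (hF hB) fun h => hAF (h ▸ hB)) ha haB
  rw [← Finset.card_powerset]
  symm
  refine Finset.card_bij (fun F _ => F.biUnion id) ?_ ?_ ?_
  · intro F hF
    rw [Finset.mem_powerset] at hF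
    refine mem_zeroSums.2 ⟨Finset.biUnion_subset.2 fun A hA => ((hM A).1 (hF hA)).1, ?_⟩
    rw [Finset.sum_biUnion (t := id) fun A hA B hB hAB => hd A (hF hA) B (hF hB) hAB]
    exact Finset.sum_eq_zero fun A hA => ((hM A).1 (hF hA)).2.2.1
  · intro F hF F' hF' h
    rw [Finset.mem_powerset] at hF hF'
    ext A
    exact ⟨fun hA => key F' hF' A (hF hA) (h ▸ Finset.subset_biUnion_of_mem id hA),
      fun hA => key F hF A (hF' hA) (h ▸ Finset.subset_biUnion_of_mem id hA)⟩
  · intro J hJ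
    obtain ⟨hJI, hJ0⟩ := mem_zeroSums.1 hJ
    refine ⟨M.filter (· ⊆ J), by simp, ?_⟩
    ext k
    simp only [Finset.mem_biUnion, Finset.mem_filter, id]
    constructor
    · rintro ⟨A, ⟨-, hA⟩, hk⟩
      exact hA hk
    · intro hk
      obtain ⟨P, hPJ, hP, hkP⟩ := exists_isMinZero_mem hJ0 hk
      exact ⟨P, ⟨(hM P).2 ⟨hPJ.trans hJI, hP⟩, hPJ⟩, hkP⟩

theorem nsub_map (s : ι → G) (I : Finset ι) (g : G) :
    NSub (I.val.map s) g = (I.powerset.filter fun J => ∑ i ∈ J, s i = g).card := by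
  rw [NSub, powerset_map_val, Multiset.filter_map, Multiset.card_map]
  rfl

theorem nsub_sum (s : ι → G) (I : Finset ι) :
    NSub (I.val.map s) (∑ i ∈ I, s i) = NSub (I.val.map s) 0 := by
  rw [nsub_map, nsub_map]
  refine Finset.card_nbij' (fun J => I \ J) (fun J => I \ J) ?_ ?_ ?_ ?_
  · intro J hJ
    obtain ⟨hJ, h⟩ := Finset.mem_filter.1 hJ
    have := Finset.sum_sdiff (f := s) (Finset.mem_powerset.1 hJ)
    rw [h] at this
    simpa using this
  · intro J hJ
    obtain ⟨hJ, h⟩ := Finset.mem_filter.1 hJ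
    have := Finset.sum_sdiff (f := s) (Finset.mem_powerset.1 hJ)
    rw [h] at this
    simpa using this
  · intro J hJ
    exact Finset.sdiff_sdiff_eq_self (Finset.mem_powerset.1 (Finset.mem_filter.1 hJ).1)
  · intro J hJ
    exact Finset.sdiff_sdiff_eq_self (Finset.mem_powerset.1 (Finset.mem_filter.1 hJ).1)

end ZeroSumFinsets

theorem stmt10 {G : Type*} [AddCommGroup G] [Fintype G] [DecidableEq G]
    (hodd : Odd (Fintype.card G))
    (S : Multiset G) (h0 : (0 : G) ∉ S)
    (hlen : Davenport G - 1 ≤ Multiset.card S)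
    (hE : ESet S = {0}) :
    ∃ F : Finset (Multiset G),
      (∀ T : Multiset G, T ∈ F ↔ T ≤ S ∧ IsMinZeroSum T) ∧
      F.card = Multiset.card S + 1 - Davenport G ∧
      (∀ T₁ ∈ F, ∀ T₂ ∈ F, T₁ ≠ T₂ → T₁ ∩ T₂ = 0) ∧
      ∑ T ∈ F, T = S := by
  classical
  obtain ⟨ι, _, s, rfl⟩ : ∃ (ι : Type) (_ : Fintype ι) (s : ι → G),
      S = (Finset.univ : Finset ι).val.map s := by
    refine ⟨Fin S.toList.length, inferInstance, S.toList.get, ?_⟩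
    conv_lhs => rw [← Multiset.coe_toList S]
    rw [Fin.univ_val_map, List.ofFn_get]
  have hs0 : ∀ i ∈ (Finset.univ : Finset ι), s i ≠ 0 := fun i hi h =>
    h0 (Multiset.mem_map.2 ⟨i, hi, h⟩)
  have hN : NSub ((Finset.univ : Finset ι).val.map s) 0 = _ :=
    (Set.ext_iff.1 hE 0).2 rfl
  have hsum : ∑ i, s i = 0 := (Set.ext_iff.1 hE _).1 ((nsub_sum s Finset.univ).trans hN)
  rw [nsub_map] at hN
  have htight : IsTight s (Finset.univ : Finset ι) := by
    unfold IsTight zeroSums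
    rw [hN, ← pow_add]
    simp only [Multiset.card_map, Finset.card_val] at hlen ⊢
    congr 1
    omega
  have hd : ∀ A ⊆ (Finset.univ : Finset ι), ∀ B ⊆ (Finset.univ : Finset ι),
      IsMinZero s A → IsMinZero s B → A ≠ B → Disjoint A B :=
    fun A hAI B hBI hA hB hAB => htight.disjoint hodd hAI hBI hA hB hAB
  obtain ⟨M, hM⟩ : ∃ M : Finset (Finset ι), ∀ A, A ∈ M ↔ A ⊆ Finset.univ ∧ IsMinZero s A :=
    ⟨Finset.univ.filter (IsMinZero s), by simp⟩
  have hMd : ∀ A ∈ M, ∀ B ∈ M, A ≠ B → Disjoint A B := fun A hA B hB =>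
    hd A ((hM A).1 hA).1 B ((hM B).1 hB).1 ((hM A).1 hA).2 ((hM B).1 hB).2
  have hval : ∀ A ∈ M, ∀ B ∈ M, A ≠ B → ∀ i ∈ A, ∀ j ∈ B, s i ≠ s j :=
    fun A hA B hB hAB i hi j hj => value_ne_of_disjoint hs0 hd ((hM A).1 hA).1 ((hM B).1 hB).1
      ((hM A).1 hA).2 ((hM B).1 hB).2 hAB hi hj
  have hinj : Set.InjOn (fun A : Finset ι => A.val.map s) M := by
    intro A hA B hB h
    by_contra hAB
    obtain ⟨i, hi⟩ := ((hM A).1 hA).2.1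
    have hmem : s i ∈ A.val.map s := Multiset.mem_map_of_mem s hi
    rw [show A.val.map s = B.val.map s from h] at hmem
    obtain ⟨j, hj, hji⟩ := Multiset.mem_map.1 hmem
    exact hval A hA B hB hAB i hi j hj hji.symm
  refine ⟨M.image fun A => A.val.map s, ?_, ?_, ?_, ?_⟩
  · intro T
    rw [Finset.mem_image]
    constructor
    · rintro ⟨A, hA, rfl⟩
      exact ⟨Multiset.map_le_map (Finset.val_le_iff.2 ((hM A).1 hA).1),
        isMinZeroSum_map_iff.2 ((hM A).1 hA).2⟩
    · rintro ⟨hT, hmin⟩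
      obtain ⟨A, hA, rfl⟩ := exists_finset_of_le_map s _ hT
      exact ⟨A, (hM A).2 ⟨hA, isMinZeroSum_map_iff.1 hmin⟩, rfl⟩
  · rw [Finset.card_image_of_injOn hinj]
    exact Nat.pow_right_injective le_rfl ((card_zeroSums_eq_two_pow hM hMd).symm.trans hN)
  · intro T₁ h₁ T₂ h₂ hne
    obtain ⟨A, hA, rfl⟩ := Finset.mem_image.1 h₁
    obtain ⟨B, hB, rfl⟩ := Finset.mem_image.1 h₂
    refine Multiset.eq_zero_of_forall_notMem fun g hg => ?_
    obtain ⟨hgA, hgB⟩ := Multiset.mem_inter.1 hg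
    obtain ⟨i, hi, rfl⟩ := Multiset.mem_map.1 hgA
    obtain ⟨j, hj, hji⟩ := Multiset.mem_map.1 hgB
    exact hval A hA B hB (fun h => hne (by rw [h])) i hi j hj hji.symm
  · rw [Finset.sum_image hinj]
    have hmap : ∀ A : Finset ι, A.val.map s = ∑ i ∈ A, {s i} := fun A => by
      rw [← Multiset.sum_map_singleton (A.val.map s), Multiset.map_map]
      rfl
    have hcover : M.biUnion id = Finset.univ := by
      refine Finset.eq_univ_of_forall fun k => ?_
      obtain ⟨P, hPI, hP, hk⟩ := exists_isMinZero_mem hsum (Finset.mem_univ k)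
      exact Finset.mem_biUnion.2 ⟨P, (hM P).2 ⟨hPI, hP⟩, hk⟩
    rw [hmap, ← hcover, Finset.sum_biUnion (t := id) fun A hA B hB hAB => hMd A hA B hB hAB]
    exact Finset.sum_congr rfl fun A _ => hmap A
end
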